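/- arXiv:1705.01074 — 7 statements merged into one kernel-verified Lean document; each statement's English description precedes it below -/
import Mathlib

section
/- If n is a positive integer with n ≡ 1 (mod 3) or n ≡ 2 (mod 6), then there exist integers x, y, z such that P_n = x^3 + y^3 + z^3. -/
/-- For a positive integer `n`, `P n = 2^(n-1) * (2^n - 1)`. -/
def P (n : ℕ) : ℤ := 2 ^ (n - 1) * (2 ^ n - 1)

theorem stmt_0 (n : ℕ) (hn : 0 < n) (h : n % 3 = 1 ∨ n % 6 = 2) :
    ∃ x y z : ℤ, P n = x ^ 3 + y ^ 3 + z ^ 3 := by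
  rcases h with h | h
  · obtain ⟨k, rfl⟩ : ∃ k, n = k * 3 + 1 := ⟨n / 3, by omega⟩
    refine ⟨(2 ^ k) ^ 2, (2 ^ k) ^ 2, -(2 ^ k), ?_⟩
    unfold P
    rw [show k * 3 + 1 - 1 = k * 3 by omega, pow_succ, pow_mul]
    ring
  · obtain ⟨k, rfl⟩ : ∃ k, n = k * 6 + 2 := ⟨n / 6, by omega⟩
    refine ⟨2 * (2 ^ k) ^ 4, -(2 ^ k) ^ 2, -(2 ^ k) ^ 2, ?_⟩
    unfold P
    rw [show k * 6 + 2 - 1 = k * 6 + 1 by omega, pow_succ, pow_add, pow_mul]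
    ring
end

section
/- If n is a positive integer with n ≡ 1 (mod 6) or n ≡ 5 (mod 6), then there exist two integer triples (x₁, y₁, z₁) and (x₂, y₂, z₂), not equal as multisets {x, y, z}, such that P_n = x₁^3 + y₁^3 + z₁^3 = x₂^3 + y₂^3 + z₂^3. -/
lemma ms_ne {a b c x y z : ℤ} (h1 : z ≠ a) (h2 : z ≠ b) (h3 : z ≠ c) :
    ({a, b, c} : Multiset ℤ) ≠ ({x, y, z} : Multiset ℤ) := by
  intro h
  have hz : z ∈ ({x, y, z} : Multiset ℤ) := by simp
  rw [← h] at hz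
  simp at hz
  tauto

lemma P_one (k : ℕ) : P (6 * k + 1) = 2 * ((2:ℤ) ^ k) ^ 12 - ((2:ℤ) ^ k) ^ 6 := by
  simp only [P, Nat.add_sub_cancel]
  rw [pow_succ, mul_comm 6 k, pow_mul]
  ring

lemma P_five (k : ℕ) : P (6 * k + 5) = 512 * ((2:ℤ) ^ k) ^ 12 - 16 * ((2:ℤ) ^ k) ^ 6 := by
  have : 6 * k + 5 - 1 = 6 * k + 4 := by omega
  simp only [P, this]
  rw [pow_add, pow_add, mul_comm 6 k, pow_mul]
  ring

theorem stmt_1 (n : ℕ) (hn : 0 < n) (h : n % 6 = 1 ∨ n % 6 = 5) :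
    ∃ x₁ y₁ z₁ x₂ y₂ z₂ : ℤ,
      ({x₁, y₁, z₁} : Multiset ℤ) ≠ ({x₂, y₂, z₂} : Multiset ℤ) ∧
      P n = x₁ ^ 3 + y₁ ^ 3 + z₁ ^ 3 ∧
      P n = x₂ ^ 3 + y₂ ^ 3 + z₂ ^ 3 := by
  rcases h with h | h
  · obtain ⟨k, rfl⟩ : ∃ k, n = 6 * k + 1 := ⟨n / 6, by omega⟩
    rw [P_one]
    rcases k with _ | _ | k
    · exact ⟨1, 1, -1, 1, 0, 0, ms_ne (by norm_num) (by norm_num) (by norm_num),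
        by norm_num, by norm_num⟩
    · exact ⟨16, 16, -4, 4, 4, 20, ms_ne (by norm_num) (by norm_num) (by norm_num),
        by norm_num, by norm_num⟩
    · have hd : (0:ℤ) < 2 ^ k := by positivity
      have e : (2:ℤ) ^ (k + 1 + 1) = 4 * 2 ^ k := by ring
      rw [e]
      generalize (2:ℤ) ^ k = d at hd
      have h2 : 0 < d ^ 2 := by positivity
      have h4 : 0 < d ^ 4 := by positivity
      refine ⟨256 * d ^ 4, 256 * d ^ 4, -16 * d ^ 2, 256 * d ^ 4 + 21 * d, 256 * d ^ 4 - 21 * d,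
        -88 * d ^ 2, ms_ne ?_ ?_ ?_, by ring, by ring⟩ <;> intro hh <;> linarith
  · obtain ⟨k, rfl⟩ : ∃ k, n = 6 * k + 5 := ⟨n / 6, by omega⟩
    rw [P_five]
    have hd : (0:ℤ) < 2 ^ k := by positivity
    generalize (2:ℤ) ^ k = d at hd
    have h2 : 0 < d ^ 2 := by positivity
    have h4 : 0 < d ^ 4 := by positivity
    refine ⟨8 * d ^ 4, -2 * d ^ 2, -2 * d ^ 2, -2 * d ^ 2 + 84 * d ^ 5, -2 * d ^ 2 - 84 * d ^ 5,
      44 * d ^ 4, ms_ne ?_ ?_ ?_, by ring, by ring⟩ <;> intro hh <;> linarith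
end

section
/- For every integer n ≥ 2, P_{6n+1} = (2^(n-2) * (2^(3n+2) - 21))^3 + (2^(n-2) * (2^(3n+2) + 21))^3 - (11 * 2^(2n-1))^3. -/
theorem stmt_4 (n : ℕ) (hn : 2 ≤ n) :
    P (6 * n + 1) =
      ((2 : ℤ) ^ (n - 2) * (2 ^ (3 * n + 2) - 21)) ^ 3 +
      ((2 : ℤ) ^ (n - 2) * (2 ^ (3 * n + 2) + 21)) ^ 3 -
      (11 * (2 : ℤ) ^ (2 * n - 1)) ^ 3 := by
  obtain ⟨k, rfl⟩ := Nat.exists_eq_add_of_le hn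
  have h1 : 6 * (2 + k) + 1 - 1 = k * 6 + 12 := by omega
  have h2 : 6 * (2 + k) + 1 = k * 6 + 13 := by omega
  have h3 : 2 + k - 2 = k := by omega
  have h4 : 3 * (2 + k) + 2 = k * 3 + 8 := by omega
  have h5 : 2 * (2 + k) - 1 = k * 2 + 3 := by omega
  unfold P
  rw [h1, h2, h3, h4, h5]
  simp only [pow_add, pow_mul]
  ring
end

section
/- For every positive integer n, P_{6n+5} = (2^(2n+1) * (2^(2(n+1)) - 2^(n+1) - 1))^3 + (2^(2n+1) * (2^(2(n+1)) + 2^(n+1) - 1))^3 - (2^(4n+3))^3. -/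
theorem stmt_6 (n : ℕ) (hn : 0 < n) :
    P (6 * n + 5) =
      ((2 : ℤ) ^ (2 * n + 1) * (2 ^ (2 * (n + 1)) - 2 ^ (n + 1) - 1)) ^ 3 +
      ((2 : ℤ) ^ (2 * n + 1) * (2 ^ (2 * (n + 1)) + 2 ^ (n + 1) - 1)) ^ 3 -
      ((2 : ℤ) ^ (4 * n + 3)) ^ 3 := by
  have h1 : 6 * n + 5 - 1 = 6 * n + 4 := by omega
  unfold P
  rw [h1]
  have e6 : (2 : ℤ) ^ (6 * n) = (2 ^ n) ^ 6 := by rw [← pow_mul, mul_comm]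
  have e4 : (2 : ℤ) ^ (4 * n) = (2 ^ n) ^ 4 := by rw [← pow_mul, mul_comm]
  have e2 : (2 : ℤ) ^ (2 * n) = (2 ^ n) ^ 2 := by rw [← pow_mul, mul_comm]
  simp only [mul_add, pow_add, e6, e4, e2]
  generalize (2 : ℤ) ^ n = x
  ring
end

section
/- Every even perfect number N can be written as a sum of three cubes of integers, i.e., there exist integers x, y, z with N = x^3 + y^3 + z^3. -/
open ArithmeticFunction in
theorem even_perfect_form (n : ℕ) (ev : Even n) (perf : Nat.Perfect n) :
    ∃ k : ℕ, Nat.Prime (2 ^ (k + 1) - 1) ∧ n = 2 ^ k * (2 ^ (k + 1) - 1) := by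
  have hpos := perf.2
  obtain ⟨k, m, hm, rfl⟩ := Nat.exists_eq_two_pow_mul_odd hpos.ne'
  have hmpos : 0 < m := hm.pos
  have hk : k ≠ 0 := by
    rintro rfl
    simp at ev
    exact (Nat.not_even_iff_odd.2 hm) ev
  refine ⟨k, ?_⟩
  have hcop : Nat.Coprime (2 ^ k) m := (Nat.coprime_two_left.2 hm).pow_left k
  have h1 := (Nat.perfect_iff_sum_divisors_eq_two_mul hpos).1 perf
  rw [hcop.sum_divisors_mul, Nat.sum_divisors_prime_pow Nat.prime_two,
    Nat.geomSum_eq le_rfl] at h1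
  simp only [Nat.add_one_sub_one, Nat.div_one] at h1
  have hge : 4 ≤ 2 ^ (k + 1) := by
    calc 4 = 2 ^ 2 := by norm_num
      _ ≤ _ := Nat.pow_le_pow_right (by norm_num) (by omega)
  have h2 : (2 ^ (k + 1) - 1) * (∑ i ∈ m.divisors, i) = 2 ^ (k + 1) * m := by
    rw [h1]; ring
  generalize hM : 2 ^ (k + 1) - 1 = M at *
  have hM1 : 2 ^ (k + 1) = M + 1 := by omega
  rw [hM1] at h2
  have hd : M ∣ m := by
    have : Nat.Coprime M (M + 1) := by simp
    exact this.dvd_of_dvd_mul_left ⟨_, h2.symm⟩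
  obtain ⟨j, rfl⟩ := hd
  have hM3 : 3 ≤ M := by omega
  have hj : 0 < j := Nat.pos_of_mul_pos_left hmpos
  have h3 : ∑ i ∈ (M * j).divisors, i = (M + 1) * j :=
    Nat.eq_of_mul_eq_mul_left (by omega : 0 < M) (by rw [h2]; ring)
  rw [Nat.sum_divisors_eq_sum_properDivisors_add_self] at h3
  have h4 : ∑ i ∈ (M * j).properDivisors, i = j := by linarith
  have h5 : ∑ i ∈ (M * j).properDivisors, i ∣ M * j := by rw [h4]; exact ⟨M, by ring⟩
  rcases Nat.sum_properDivisors_dvd h5 with h | h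
  · have hp := Nat.sum_properDivisors_eq_one_iff_prime.1 h
    have : j = 1 := by omega
    subst this
    simpa using hp
  · rw [h4] at h; nlinarith

theorem stmt_8 (N : ℕ) (hN : Nat.Perfect N) (hE : Even N) :
    ∃ x y z : ℤ, (N : ℤ) = x ^ 3 + y ^ 3 + z ^ 3 := by
  obtain ⟨k, hp, rfl⟩ := even_perfect_form N hE hN
  have hc : ((2 ^ k * (2 ^ (k + 1) - 1) : ℕ) : ℤ) = 2 ^ k * (2 ^ (k + 1) - 1) := by
    push_cast [Nat.one_le_two_pow]; ring
  rw [hc]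
  obtain ⟨q, h | h | h⟩ : ∃ q, k = 3 * q ∨ k = 3 * q + 1 ∨ k = 3 * q + 2 := ⟨k / 3, by omega⟩
  · subst h
    exact ⟨2 ^ (2 * q), 2 ^ (2 * q), -2 ^ q, by ring⟩
  · subst h
    exact ⟨2 ^ (2 * q + 1), -2 ^ q, -2 ^ q, by ring⟩
  · subst h
    have h7 : 7 ∣ 2 ^ (3 * q + 2 + 1) - 1 := by
      have := Nat.sub_dvd_pow_sub_pow 8 1 (q + 1)
      rw [show 3 * q + 2 + 1 = 3 * (q + 1) by ring, pow_mul]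
      simpa using this
    have h8 := (Nat.prime_dvd_prime_iff_eq (by norm_num) hp).1 h7
    have h9 : 2 ^ (3 * q + 2 + 1) = 2 ^ 3 := by omega
    have h10 := Nat.pow_right_injective le_rfl h9
    have : q = 0 := by omega
    subst this
    exact ⟨3, 1, 0, by norm_num⟩
end

section
/- For every even perfect number N, there exist two integer triples (x₁, y₁, z₁) and (x₂, y₂, z₂), not equal as multisets {x, y, z}, such that N = x₁^3 + y₁^3 + z₁^3 = x₂^3 + y₂^3 + z₂^3. -/
theorem euler_aux (N : ℕ) (hN : Nat.Perfect N) (hE : Even N) :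
    ∃ p : ℕ, p.Prime ∧ (N : ℤ) * 2 = 2 ^ p * (2 ^ p - 1) := by
  have hpos := hN.2
  rw [Nat.perfect_iff_sum_divisors_eq_two_mul hpos] at hN
  obtain ⟨k, m, hm, rfl⟩ := Nat.exists_eq_two_pow_mul_odd hpos.ne'
  have hk : k ≠ 0 := by
    rintro rfl
    simp at hE
    exact (Nat.not_even_iff_odd.2 hm) hE
  have hcop : Nat.Coprime (2 ^ k) m := (Nat.coprime_two_left.2 hm).pow_left k
  rw [hcop.sum_divisors_mul, Nat.sum_divisors_prime_pow Nat.prime_two] at hN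
  have hg : ∑ x ∈ Finset.range (k + 1), 2 ^ x = 2 ^ (k + 1) - 1 := by
    have := Nat.geomSum_eq (le_refl 2) (k + 1)
    simpa using this
  rw [hg] at hN
  obtain ⟨M, hM⟩ : ∃ M, 2 ^ (k + 1) = M + 1 := ⟨2 ^ (k + 1) - 1, by
    have := Nat.one_le_two_pow (n := k + 1); omega⟩
  have hM1 : 1 < M := by
    have : 2 ^ 2 ≤ 2 ^ (k + 1) := Nat.pow_le_pow_right (by norm_num) (by omega)
    omega
  have e : M * ∑ d ∈ m.divisors, d = (M + 1) * m := by
    rw [← hM, pow_succ]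
    rw [hM] at hN
    simp only [Nat.add_sub_cancel] at hN
    linarith
  have hd : M ∣ m := by
    have h1 : M ∣ (M + 1) * m := ⟨_, e.symm⟩
    exact (Nat.Coprime.dvd_of_dvd_mul_left (by simp) h1)
  obtain ⟨j, rfl⟩ := hd
  rw [Nat.sum_divisors_eq_sum_properDivisors_add_self] at e
  have hs : ∑ d ∈ (M * j).properDivisors, d = j := by
    have h2 : M * (∑ d ∈ (M * j).properDivisors, d) = M * j := by nlinarith
    exact Nat.eq_of_mul_eq_mul_left (by omega) h2
  have hj : 0 < j := by
    rcases Nat.eq_zero_or_pos j with h | h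
    · subst h; simp at hpos
    · exact h
  have hj1 : j = 1 := by
    rcases Nat.sum_properDivisors_dvd (n := M * j) (by rw [hs]; exact dvd_mul_left _ _) with h | h
    · rw [hs] at h; exact h
    · rw [hs] at h; nlinarith
  subst hj1
  rw [Nat.sum_properDivisors_eq_one_iff_prime, mul_one] at hs
  have hM' : M = 2 ^ (k + 1) - 1 := by omega
  refine ⟨k + 1, ?_, ?_⟩
  · rw [hM'] at hs
    exact (Nat.prime_of_pow_sub_one_prime (by omega) hs).2
  · have : (2 : ℤ) ^ (k + 1) = M + 1 := by exact_mod_cast hM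
    rw [show (2 : ℤ) ^ (k + 1) - 1 = M by linarith]
    push_cast
    ring

theorem stmt_9 (N : ℕ) (hN : Nat.Perfect N) (hE : Even N) :
    ∃ x₁ y₁ z₁ x₂ y₂ z₂ : ℤ,
      ({x₁, y₁, z₁} : Multiset ℤ) ≠ ({x₂, y₂, z₂} : Multiset ℤ) ∧
      (N : ℤ) = x₁ ^ 3 + y₁ ^ 3 + z₁ ^ 3 ∧
      (N : ℤ) = x₂ ^ 3 + y₂ ^ 3 + z₂ ^ 3 := by
  obtain ⟨p, hp, h⟩ := euler_aux N hN hE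
  have key : ∀ x y z u v w : ℤ, z ≠ u → z ≠ v → z ≠ w →
      ({x, y, z} : Multiset ℤ) ≠ ({u, v, w} : Multiset ℤ) := by
    intro x y z u v w h1 h2 h3 he
    have : z ∈ ({x, y, z} : Multiset ℤ) := by simp
    rw [he] at this
    simp at this
    tauto
  have hp2 := hp.two_le
  by_cases h2 : p = 2
  · subst h2
    exact ⟨-1, -1, 2, -58, -43, 65, by decide, by linarith, by linarith⟩
  by_cases h3 : p = 3
  · subst h3
    exact ⟨0, 1, 3, -17, 13, 14, by decide, by linarith, by linarith⟩
  have n2 : ¬ 2 ∣ p := fun hd => h2 ((Nat.prime_dvd_prime_iff_eq Nat.prime_two hp).1 hd).symm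
  have n3 : ¬ 3 ∣ p := fun hd => h3 ((Nat.prime_dvd_prime_iff_eq Nat.prime_three hp).1 hd).symm
  have hc : ∃ m, (p = 6 * m + 1 ∧ 1 ≤ m) ∨ p = 6 * m + 5 := ⟨p / 6, by omega⟩
  obtain ⟨m, ⟨rfl, hm⟩ | rfl⟩ := hc
  · obtain ⟨a, ha⟩ : ∃ a : ℤ, a = 2 ^ m := ⟨_, rfl⟩
    have ha2 : 2 ≤ a := by
      rw [ha]
      calc (2 : ℤ) = 2 ^ 1 := by norm_num
        _ ≤ 2 ^ m := pow_le_pow_right₀ (by norm_num) hm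
    have hpw : (2 : ℤ) ^ (6 * m + 1) = 2 * a ^ 6 := by rw [ha]; ring
    rw [hpw] at h
    have hsq : 0 < a ^ 2 := by positivity
    refine ⟨a ^ 4, a ^ 4, -a ^ 2, a ^ 4 + a ^ 3 - a ^ 2, a ^ 4 - a ^ 3 - a ^ 2, a ^ 2,
      key _ _ _ _ _ _ ?_ ?_ ?_, by linarith, by linarith⟩
    · have : 0 < a ^ 4 + a ^ 3 := by positivity
      intro h'; linarith
    · intro h'
      have : a ^ 3 * (a - 1) = 0 := by linarith
      have : 0 < a ^ 3 * (a - 1) := mul_pos (by positivity) (by linarith)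
      linarith
    · intro h'; linarith
  · obtain ⟨a, ha⟩ : ∃ a : ℤ, a = 2 ^ m := ⟨_, rfl⟩
    have ha1 : 1 ≤ a := by rw [ha]; exact one_le_pow₀ (by norm_num)
    have hpw : (2 : ℤ) ^ (6 * m + 5) = 32 * a ^ 6 := by rw [ha]; ring
    rw [hpw] at h
    refine ⟨2 * a ^ 2 * (4 * a ^ 2), 2 * a ^ 2 * (-1), 2 * a ^ 2 * (-1), 2 * a ^ 2 * (4 * a ^ 2 + 2 * a - 1),
      2 * a ^ 2 * (4 * a ^ 2 - 2 * a - 1), 2 * a ^ 2 * (-(4 * a ^ 2)),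
      key _ _ _ _ _ _ ?_ ?_ ?_, by linarith, by linarith⟩
    all_goals
      intro h'
      have h'' := mul_left_cancel₀ (by positivity : (2 * a ^ 2) ≠ 0) h'
      nlinarith
end

section
/- For every positive integer n, there exist integers x, y, z, w such that P_n = x^3 + y^3 + z^3 + w^3. -/
theorem four_pow_aux (k : ℕ) : ∃ a : ℤ, (4 : ℤ) ^ k = 3 * a + 1 := by
  induction k with
  | zero => exact ⟨0, by norm_num⟩
  | succ k ih =>
    obtain ⟨a, ha⟩ := ih
    exact ⟨4 * a + 1, by rw [pow_succ, ha]; ring⟩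

theorem stmt_10 (n : ℕ) (hn : 0 < n) :
    ∃ x y z w : ℤ, P n = x ^ 3 + y ^ 3 + z ^ 3 + w ^ 3 := by
  have h : n = 1 ∨ (∃ k, n = 2 * k + 2) ∨ ∃ k, n = 2 * k + 3 := by
    rcases Nat.even_or_odd' n with ⟨m, h | h⟩
    · exact Or.inr (Or.inl ⟨m - 1, by omega⟩)
    · by_cases h1 : n = 1
      · exact Or.inl h1
      · exact Or.inr (Or.inr ⟨m - 1, by omega⟩)
  rcases h with rfl | ⟨k, rfl⟩ | ⟨k, rfl⟩
  · exact ⟨1, 0, 0, 0, by norm_num [P]⟩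
  · obtain ⟨a, ha⟩ := four_pow_aux k
    have hp : P (2 * k + 2) = 6 * ((3 * a + 1) * (4 * a + 1)) := by
      have e : 2 * k + 2 - 1 = 2 * k + 1 := by omega
      have h2 : (2 : ℤ) ^ (2 * k) = 3 * a + 1 := by rw [pow_mul, ← ha]; norm_num
      rw [P, e, pow_add, pow_add, h2]; ring
    refine ⟨(3 * a + 1) * (4 * a + 1) + 1, (3 * a + 1) * (4 * a + 1) - 1,
      -((3 * a + 1) * (4 * a + 1)), -((3 * a + 1) * (4 * a + 1)), ?_⟩
    rw [hp]; ring
  · obtain ⟨a, ha⟩ := four_pow_aux k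
    obtain ⟨y, hy⟩ : ∃ y : ℤ, y = -(16 * a ^ 2 + 10 * a + 1) - 1 := ⟨_, rfl⟩
    have hp : P (2 * k + 3) = -(18 * y + 8) := by
      have e : 2 * k + 3 - 1 = 2 * k + 2 := by omega
      have h2 : (2 : ℤ) ^ (2 * k) = 3 * a + 1 := by rw [pow_mul, ← ha]; norm_num
      rw [P, e, pow_add, pow_add, h2, hy]; ring
    refine ⟨-y + 5, y - 14, 3 * y - 29, 30 - 3 * y, ?_⟩
    rw [hp]; ring
end
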